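/- Every 𝒦(𝓜)-paracompact normal Moore space is metrizable. -/

import Mathlib

open Set TopologicalSpace Topology

/-- A family of sets is locally finite at a point `x`: `x` has a neighborhood meeting
only finitely many members of the family. -/
def LocallyFiniteAt {X : Type*} [TopologicalSpace X] (x : X) (C : Set (Set X)) : Prop :=
  ∃ U ∈ nhds x, {A ∈ C | (A ∩ U).Nonempty}.Finite

/-- A family of sets is locally finite in `X`. -/
def LocallyFiniteFamily {X : Type*} [TopologicalSpace X] (C : Set (Set X)) : Prop :=
  ∀ x : X, LocallyFiniteAt x C

/-- A poset is directed: every pair of elements has an upper bound. -/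
def DirectedPoset (P : Type*) [Preorder P] : Prop :=
  ∀ a b : P, ∃ c : P, a ≤ c ∧ b ≤ c

/-- A poset has calibre (ω₁,ω) if every uncountable subset contains an infinite
subset with an upper bound. -/
def CalibreOmega1Omega (P : Type*) [Preorder P] : Prop :=
  ∀ S : Set P, ¬ S.Countable → ∃ T ⊆ S, T.Infinite ∧ ∃ b : P, ∀ t ∈ T, t ≤ b

/-- A collection `C` of subsets of `X` is `P`-locally finite. -/
def PLocallyFinite (P : Type*) [Preorder P] {X : Type*} [TopologicalSpace X]
    (C : Set (Set X)) : Prop :=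
  ∃ c : P → Set (Set X), (∀ p p' : P, p ≤ p' → c p ⊆ c p') ∧
    (∀ p, LocallyFiniteFamily (c p)) ∧ (⋃ p, c p) = C

def IsOpenCover {X : Type*} [TopologicalSpace X] (U : Set (Set X)) : Prop :=
  (∀ V ∈ U, IsOpen V) ∧ ⋃₀ U = univ

def IsRefinement {X : Type*} (V U : Set (Set X)) : Prop :=
  ∀ W ∈ V, ∃ W' ∈ U, W ⊆ W'

/-- `X` is `P`-paracompact: every open cover has a `P`-locally finite open refinement. -/
def PParacompact (P : Type*) [Preorder P] (X : Type*) [TopologicalSpace X] : Prop :=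
  ∀ U : Set (Set X), IsOpenCover U →
    ∃ V : Set (Set X), IsOpenCover V ∧ IsRefinement V U ∧ PLocallyFinite P V

/-- A collection is (ω₁,ω)-locally finite: every uncountable subcollection contains
an infinite locally finite subcollection. -/
def Omega1OmegaLF {X : Type*} [TopologicalSpace X] (C : Set (Set X)) : Prop :=
  ∀ D ⊆ C, ¬ D.Countable → ∃ E ⊆ D, E.Infinite ∧ LocallyFiniteFamily E

def Omega1OmegaParacompact (X : Type*) [TopologicalSpace X] : Prop :=
  ∀ U : Set (Set X), IsOpenCover U →
    ∃ V : Set (Set X), IsOpenCover V ∧ IsRefinement V U ∧ Omega1OmegaLF V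

/-- `B` is a base for the topology of `X`. -/
def IsBase {X : Type*} [TopologicalSpace X] (B : Set (Set X)) : Prop :=
  (∀ b ∈ B, IsOpen b) ∧ ∀ U : Set X, IsOpen U → ∀ x ∈ U, ∃ b ∈ B, x ∈ b ∧ b ⊆ U

/-- `X` is `P`-metrizable: it has a `(P × ℕ)`-locally finite base. -/
def PMetrizable (P : Type*) [Preorder P] (X : Type*) [TopologicalSpace X] : Prop :=
  ∃ B : Set (Set X), IsBase B ∧ PLocallyFinite (P × ℕ) B

def Omega1OmegaMetrizable (X : Type*) [TopologicalSpace X] : Prop :=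
  ∃ B : Set (Set X), IsBase B ∧ Omega1OmegaLF B

/-- Pseudocompact: every locally finite family of nonempty open sets is finite. -/
def Pseudocompact (X : Type*) [TopologicalSpace X] : Prop :=
  ∀ C : Set (Set X), (∀ U ∈ C, IsOpen U ∧ U.Nonempty) → LocallyFiniteFamily C → C.Finite

/-- The directed set of compact subsets of `M`, ordered by inclusion. -/
abbrev KM (M : Type*) [TopologicalSpace M] : Type _ := {K : Set M // IsCompact K}

/-- `X` is 𝒦(𝓜)-paracompact: every open cover has a `𝒦(M)`-locally finite open
refinement for some separable metrizable `M`. -/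
def KMclassParacompact (X : Type*) [TopologicalSpace X] : Prop :=
  ∀ U : Set (Set X), IsOpenCover U →
    ∃ (M : Type) (_ : TopologicalSpace M), SeparableSpace M ∧ MetrizableSpace M ∧
      ∃ V : Set (Set X), IsOpenCover V ∧ IsRefinement V U ∧ PLocallyFinite (KM M) V

/-- Weakly σ-locally finite collection. -/
def WeaklySigmaLF {X : Type*} [TopologicalSpace X] (C : Set (Set X)) : Prop :=
  ∃ c : ℕ → Set (Set X), (⋃ n, c n) = C ∧
    ∀ x : X, ∀ A ∈ C, ∃ n, A ∈ c n ∧ LocallyFiniteAt x (c n)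

/-- Relatively locally finite: locally finite at every point of its union. -/
def RelLocallyFinite {X : Type*} [TopologicalSpace X] (C : Set (Set X)) : Prop :=
  ∀ x ∈ ⋃₀ C, LocallyFiniteAt x C

def SigmaRelLF {X : Type*} [TopologicalSpace X] (C : Set (Set X)) : Prop :=
  ∃ c : ℕ → Set (Set X), (⋃ n, c n) = C ∧ ∀ n, RelLocallyFinite (c n)

def SigmaRelParacompact (X : Type*) [TopologicalSpace X] : Prop :=
  ∀ U : Set (Set X), IsOpenCover U →
    ∃ V : Set (Set X), IsOpenCover V ∧ IsRefinement V U ∧ SigmaRelLF V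

/-- An open set `U` is `P`-regular. -/
def PRegular (P : Type*) [Preorder P] {X : Type*} [TopologicalSpace X] (U : Set X) : Prop :=
  ∃ V : P × ℕ → Set X, (∀ q, IsOpen (V q)) ∧ (∀ q q' : P × ℕ, q ≤ q' → V q ⊆ V q') ∧
    (⋃ q, V q) = U ∧ (⋃ q, closure (V q)) = U

def PPerfectlyNormal (P : Type*) [Preorder P] (X : Type*) [TopologicalSpace X] : Prop :=
  ∀ U : Set X, IsOpen U → PRegular P U

/-- A development for `X`. -/
def IsDevelopment {X : Type*} [TopologicalSpace X] (G : ℕ → Set (Set X)) : Prop :=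
  (∀ n, IsOpenCover (G n)) ∧
    ∀ (x : X) (U : Set X), IsOpen U → x ∈ U → ∃ n, ⋃₀ {g ∈ G n | x ∈ g} ⊆ U

/-- A Moore space is a regular Hausdorff space with a development; here we record
just the existence of a development (regularity is a separate hypothesis). -/
def HasDevelopment (X : Type*) [TopologicalSpace X] : Prop :=
  ∃ G : ℕ → Set (Set X), IsDevelopment G

/-- Countably paracompact: every countable open cover has a locally finite open refinement. -/
def CountablyParacompact (X : Type*) [TopologicalSpace X] : Prop :=
  ∀ U : Set (Set X), IsOpenCover U → U.Countable →
    ∃ V : Set (Set X), IsOpenCover V ∧ IsRefinement V U ∧ LocallyFiniteFamily V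

/-- ccc: every pairwise disjoint family of nonempty open sets is countable. -/
def CCC (X : Type*) [TopologicalSpace X] : Prop :=
  ∀ C : Set (Set X), (∀ U ∈ C, IsOpen U ∧ U.Nonempty) → C.Pairwise Disjoint → C.Countable

/-- Cofinal subset of a preorder. -/
def CofinalSet {P : Type*} [Preorder P] (C : Set P) : Prop :=
  ∀ p : P, ∃ c ∈ C, p ≤ c

/-- `Q` is a Tukey quotient of `P`. -/
def TukeyQuotient (P : Type*) [Preorder P] (Q : Type*) [Preorder Q] : Prop :=
  ∃ φ : P → Q, ∀ C : Set P, CofinalSet C → CofinalSet (φ '' C)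

/-- If compact sets `L n` shrink towards a compact `K`, the union is compact. -/
lemma aux_compact {M : Type*} [MetricSpace M] {K : Set M} (hK : IsCompact K) (L : ℕ → Set M)
    (hL : ∀ n, IsCompact (L n))
    (hLK : ∀ n, L n ⊆ Metric.thickening (1 / ((n : ℝ) + 1)) K) :
    IsCompact (K ∪ ⋃ n, L n) := by
  refine isCompact_of_finite_subcover ?_
  intro ι U hU hc
  obtain ⟨t, ht⟩ := hK.elim_finite_subcover U hU (subset_union_left.trans hc)
  obtain ⟨δ, hδ, hth⟩ := hK.exists_thickening_subset_open
    (isOpen_biUnion (fun i (_ : i ∈ t) => hU i)) ht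
  obtain ⟨N, hN⟩ := exists_nat_one_div_lt hδ
  have hfin : IsCompact (⋃ n ∈ Finset.range N, L n) :=
    (Finset.range N).isCompact_biUnion (fun n _ => hL n)
  obtain ⟨t', ht'⟩ := hfin.elim_finite_subcover U hU (by
    refine Subset.trans ?_ hc
    intro x hx
    simp only [mem_iUnion] at hx
    obtain ⟨n, _, hx⟩ := hx
    exact Or.inr (mem_iUnion.2 ⟨n, hx⟩))
  classical
  refine ⟨t ∪ t', ?_⟩
  have h1 : (⋃ i ∈ t, U i) ⊆ ⋃ i ∈ t ∪ t', U i :=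
    biUnion_subset_biUnion_left (fun i hi => Finset.mem_union_left _ hi)
  have h2 : (⋃ i ∈ t', U i) ⊆ ⋃ i ∈ t ∪ t', U i :=
    biUnion_subset_biUnion_left (fun i hi => Finset.mem_union_right _ hi)
  rintro x (hx | hx)
  · exact h1 (ht hx)
  · obtain ⟨n, hx⟩ := mem_iUnion.1 hx
    by_cases hn : n < N
    · exact h2 (ht' (mem_biUnion (Finset.mem_range.2 hn) hx))
    · refine h1 (hth (Metric.thickening_mono ?_ _ (hLK n hx)))
      refine le_trans ?_ hN.le
      have : (N : ℝ) ≤ n := by exact_mod_cast not_lt.1 hn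
      exact one_div_le_one_div_of_le (by positivity) (by linarith)

/-- A `𝒦(M)`-locally finite family in a first countable space is weakly σ-locally finite. -/
lemma aux_weakly {X : Type*} [TopologicalSpace X] [FirstCountableTopology X]
    {M : Type} [TopologicalSpace M] [SecondCountableTopology M] [MetrizableSpace M]
    {V : Set (Set X)} (hV : PLocallyFinite (KM M) V) :
    ∃ c : Finset (countableBasis M) → Set (Set X), (∀ S, c S ⊆ V) ∧
      ∀ x : X, ∀ A ∈ V, ∃ S, A ∈ c S ∧ LocallyFiniteAt x (c S) := by
  obtain ⟨v, hmono, hlf, rfl⟩ := hV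
  have hsel : ∀ A : Set X, ∃ K : KM M, A ∈ (⋃ p, v p) → A ∈ v K := by
    intro A
    by_cases h : A ∈ ⋃ p, v p
    · obtain ⟨K, hK⟩ := mem_iUnion.1 h
      exact ⟨K, fun _ => hK⟩
    · exact ⟨⟨∅, isCompact_empty⟩, fun h' => (h h').elim⟩
  choose k hk using hsel
  refine ⟨fun S => {A | A ∈ (⋃ p, v p) ∧ (k A).1 ⊆ ⋃ b ∈ S, b.1}, fun S A hA => hA.1, ?_⟩
  intro x A hA
  let _ : MetricSpace M := metrizableSpaceMetric M
  by_contra! hcon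
  have hS : ∀ n : ℕ, ∃ S : Finset (countableBasis M), (k A).1 ⊆ (⋃ b ∈ S, b.1) ∧
      (⋃ b ∈ S, b.1) ⊆ Metric.thickening (1 / ((n : ℝ) + 1)) (k A).1 := by
    intro n
    let T := Metric.thickening (1 / ((n : ℝ) + 1)) (k A).1
    have hKT : (k A).1 ⊆ T := Metric.self_subset_thickening (by positivity) _
    obtain ⟨t, ht⟩ := (k A).2.elim_finite_subcover
      (fun b : {b : countableBasis M // b.1 ⊆ T} => b.1.1)
      (fun b => isOpen_of_mem_countableBasis b.1.2) (by
        intro y hy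
        obtain ⟨b, hb, hyb, hbT⟩ := (isBasis_countableBasis M).exists_subset_of_mem_open
          (hKT hy) Metric.isOpen_thickening
        exact mem_iUnion.2 ⟨⟨⟨b, hb⟩, hbT⟩, hyb⟩)
    classical
    refine ⟨t.image Subtype.val, ?_, ?_⟩
    · intro y hy
      obtain ⟨b, hb, hyb⟩ := mem_iUnion₂.1 (ht hy)
      exact mem_iUnion₂.2 ⟨b.1, Finset.mem_image_of_mem _ hb, hyb⟩
    · intro y hy
      obtain ⟨b, hb, hyb⟩ := mem_iUnion₂.1 hy
      obtain ⟨b', _, rfl⟩ := Finset.mem_image.1 hb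
      exact b'.2 hyb
  choose S hS1 hS2 using hS
  obtain ⟨U, hU⟩ := (nhds x).exists_antitone_basis
  have hinf : ∀ n, {B | (B ∈ (⋃ p, v p) ∧ (k B).1 ⊆ ⋃ b ∈ S n, b.1) ∧
      (B ∩ U n).Nonempty}.Infinite := by
    intro n hf
    exact hcon (S n) ⟨hA, hS1 n⟩ ⟨U n, hU.1.mem_of_mem trivial, hf⟩
  obtain ⟨f, hf1, hf2⟩ := exists_seq_of_forall_finset_exists
    (fun p : ℕ × Set X => (p.2 ∈ (⋃ p, v p) ∧ (k p.2).1 ⊆ ⋃ b ∈ S p.1, b.1) ∧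
      (p.2 ∩ U p.1).Nonempty) (fun p q => p.1 < q.1 ∧ p.2 ≠ q.2) (by
    intro s _
    classical
    obtain ⟨n, hn⟩ : ∃ n, ∀ p ∈ s, p.1 < n := by
      obtain ⟨m, hm⟩ := (s.image Prod.fst).bddAbove
      exact ⟨m + 1, fun p hp => Nat.lt_succ_of_le (hm (Finset.mem_coe.2 (Finset.mem_image_of_mem _ hp)))⟩
    obtain ⟨B, hB, hBs⟩ := (hinf n).exists_notMem_finset (s.image Prod.snd)
    refine ⟨(n, B), hB, fun p hp => ⟨hn p hp, ?_⟩⟩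
    rintro rfl
    exact hBs (Finset.mem_image_of_mem _ hp))
  have hsm : StrictMono (fun n => (f n).1) := fun m n h => (hf2 m n h).1
  have hge : ∀ n, n ≤ (f n).1 := fun n => hsm.id_le n
  have hinj : Function.Injective (fun n => (f n).2) := by
    intro m n h
    rcases lt_trichotomy m n with h' | h' | h'
    · exact ((hf2 m n h').2 h).elim
    · exact h'
    · exact ((hf2 n m h').2 h.symm).elim
  have hcomp := aux_compact (k A).2 (fun n => (k (f n).2).1) (fun n => (k (f n).2).2) (by
    intro n
    refine ((hf1 n).1.2.trans (hS2 _)).trans (Metric.thickening_mono ?_ _)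
    have : (n : ℝ) ≤ (f n).1 := by exact_mod_cast hge n
    exact one_div_le_one_div_of_le (by positivity) (by linarith))
  obtain ⟨W, hW, hfin⟩ := hlf ⟨_, hcomp⟩ x
  obtain ⟨N, -, hN⟩ := hU.1.mem_iff.1 hW
  refine Set.infinite_of_injective_forall_mem (f := fun n => (f (n + N)).2)
    (fun m n h => by simpa using hinj h) ?_ hfin
  intro n
  refine ⟨hmono _ _ ?_ (hk _ (hf1 (n + N)).1.1), ?_⟩
  · exact fun y hy => Or.inr (mem_iUnion.2 ⟨n + N, hy⟩)
  · refine (hf1 (n + N)).2.mono (inter_subset_inter_right _ ((hU.2 ?_).trans hN))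
    exact le_trans (Nat.le_add_left _ _) (hge _)

lemma aux_perfect {X : Type*} [TopologicalSpace X] [NormalSpace X]
    {G : ℕ → Set (Set X)} (hG : IsDevelopment G) : PerfectlyNormalSpace X where
  closed_gdelta := by
    intro C hC
    have : C = ⋂ n, ⋃₀ {g ∈ G n | (g ∩ C).Nonempty} := by
      ext x
      simp only [mem_iInter]
      constructor
      · intro hx n
        have : x ∈ ⋃₀ G n := by rw [(hG.1 n).2]; trivial
        obtain ⟨g, hg, hxg⟩ := this
        exact ⟨g, ⟨hg, x, hxg, hx⟩, hxg⟩
      · intro h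
        by_contra hx
        obtain ⟨n, hn⟩ := hG.2 x Cᶜ hC.isOpen_compl hx
        obtain ⟨g, ⟨hg, y, hyg, hyC⟩, hxg⟩ := h n
        exact hn ⟨g, ⟨hg, hxg⟩, hyg⟩ hyC
    rw [this]
    exact .iInter_of_isOpen fun n => isOpen_sUnion fun g hg => (hG.1 n).1 g hg.1

lemma aux_first {X : Type*} [TopologicalSpace X]
    {G : ℕ → Set (Set X)} (hG : IsDevelopment G) : FirstCountableTopology X where
  nhds_generated_countable x := by
    have : (nhds x).HasBasis (fun _ : ℕ => True) (fun n => ⋃₀ {g ∈ G n | x ∈ g}) := by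
      refine ⟨fun t => ⟨fun ht => ?_, ?_⟩⟩
      · obtain ⟨U, hUt, hU, hx⟩ := mem_nhds_iff.1 ht
        obtain ⟨n, hn⟩ := hG.2 x U hU hx
        exact ⟨n, trivial, hn.trans hUt⟩
      · rintro ⟨n, -, hn⟩
        refine Filter.mem_of_superset (IsOpen.mem_nhds
          (isOpen_sUnion fun g hg => (hG.1 n).1 g hg.1) ?_) hn
        have : x ∈ ⋃₀ G n := by rw [(hG.1 n).2]; trivial
        obtain ⟨g, hg, hxg⟩ := this
        exact ⟨g, ⟨hg, hxg⟩, hxg⟩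
    exact this.isCountablyGenerated

lemma aux_cozero {X : Type*} [TopologicalSpace X] [PerfectlyNormalSpace X] (U : Set X)
    (hU : IsOpen U) : ∃ f : X → ℝ, Continuous f ∧ (∀ x, 0 ≤ f x) ∧ ∀ x, 0 < f x ↔ x ∈ U := by
  obtain ⟨f, hf, h01⟩ := perfectlyNormalSpace_iff_forall_isClosed_preimage_zero.1 inferInstance Uᶜ hU.isClosed_compl
  refine ⟨fun x => |f x|, by fun_prop, fun x => abs_nonneg _, fun x => ?_⟩
  have : x ∈ Uᶜ ↔ f x = 0 := by rw [hf]; rfl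
  rw [abs_pos, ne_eq, ← this, mem_compl_iff, not_not]

/-- The key map: for a family `c` of open sets there are functions into `c →ᵤ ℝ`. -/
lemma aux_map {X : Type*} [TopologicalSpace X] [PerfectlyNormalSpace X] (c : Set (Set X))
    (hc : ∀ A ∈ c, IsOpen A) :
    ∃ F : X → (UniformFun c ℝ), Continuous F ∧
      ∀ (A : c) (x : X), 0 < UniformFun.toFun (F x) A ↔ x ∈ A.1 ∧ LocallyFiniteAt x c := by
  let W : Set X := {x | LocallyFiniteAt x c}
  have hW : IsOpen W := by
    rw [isOpen_iff_mem_nhds]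
    rintro x ⟨U, hU, hf⟩
    filter_upwards [eventually_mem_nhds_iff.2 hU] with y hy
    exact ⟨U, hy, hf⟩
  obtain ⟨g, hgc, hg0, hg⟩ := aux_cozero W hW
  choose f hfc hf0 hf using fun A : c => aux_cozero A.1 (hc A.1 A.2)
  refine ⟨fun x => UniformFun.ofFun fun A => min (f A x) (g x), ?_, ?_⟩
  · rw [continuous_iff_continuousAt]
    intro x
    rw [ContinuousAt, UniformFun.tendsto_iff_tendstoUniformly, Metric.tendstoUniformly_iff]
    intro ε hε
    simp only [Function.comp, UniformFun.toFun_ofFun]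
    by_cases hx : x ∈ W
    · obtain ⟨U, hU, hfin⟩ := hx
      have hfin' : {A : c | (A.1 ∩ U).Nonempty}.Finite := by
        refine Set.Finite.of_finite_image (f := Subtype.val) (hfin.subset ?_)
          Subtype.val_injective.injOn
        rintro _ ⟨A, hA, rfl⟩
        exact ⟨A.2, hA⟩
      have hev : ∀ᶠ y in nhds x, ∀ A ∈ {A : c | (A.1 ∩ U).Nonempty},
          dist (min (f A x) (g x)) (min (f A y) (g y)) < ε := by
        rw [Filter.eventually_all_finite hfin']
        intro A _
        have : ContinuousAt (fun y => min (f A y) (g y)) x :=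
          ((hfc A).min hgc).continuousAt
        filter_upwards [Metric.tendsto_nhds.1 this ε hε] with y hy
        rwa [dist_comm]
      filter_upwards [hev, hU] with y hy hyU A
      by_cases hA : (A.1 ∩ U).Nonempty
      · exact hy A hA
      · have key : ∀ z ∈ U, min (f A z) (g z) = 0 := by
          intro z hz
          have : ¬ 0 < f A z := fun h => hA ⟨z, (hf A z).1 h, hz⟩
          have h0 : f A z = 0 := le_antisymm (not_lt.1 this) (hf0 A z)
          rw [h0, min_eq_left (hg0 z)]
        rw [key x (mem_of_mem_nhds hU), key y hyU, dist_self]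
        exact hε
    · have hgx : g x = 0 := le_antisymm (not_lt.1 fun h => hx ((hg x).1 h)) (hg0 x)
      have : ∀ᶠ y in nhds x, g y < ε :=
        hgc.continuousAt.eventually_lt_const (by rw [hgx]; exact hε)
      filter_upwards [this] with y hy A
      rw [hgx, min_eq_right (hf0 A x), dist_comm, Real.dist_eq, sub_zero,
        abs_of_nonneg (le_min (hf0 A y) (hg0 y))]
      exact (min_le_right _ _).trans_lt hy
  · intro A x
    change 0 < min (f A x) (g x) ↔ _
    rw [lt_min_iff, hf, hg]
    rfl

/-- Every 𝒦(𝓜)-paracompact normal Moore space is metrizable. -/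
theorem statement15 (X : Type*) [TopologicalSpace X] [T2Space X] [RegularSpace X]
    (hmoore : HasDevelopment X)
    [NormalSpace X]
    (hkm : KMclassParacompact X) :
    MetrizableSpace X := by
  obtain ⟨G, hG⟩ := hmoore
  have := aux_perfect hG
  have := aux_first hG
  have step : ∀ n, ∃ (ι : Type) (_ : Countable ι) (c : ι → Set (Set X)),
      (∀ i, ∀ A ∈ c i, IsOpen A ∧ ∃ g ∈ G n, A ⊆ g) ∧
      ∀ x, ∃ i, ∃ A ∈ c i, x ∈ A ∧ LocallyFiniteAt x (c i) := by
    intro n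
    obtain ⟨M, _, _, _, V, hV, hr, hlf⟩ := hkm (G n) (hG.1 n)
    let _ : MetricSpace M := metrizableSpaceMetric M
    have : SecondCountableTopology M := UniformSpace.secondCountable_of_separable M
    obtain ⟨c, hcV, hc⟩ := aux_weakly hlf
    have : Countable (countableBasis M) := (countable_countableBasis M).to_subtype
    refine ⟨Finset (countableBasis M), inferInstance, c,
      fun i A hA => ⟨hV.1 A (hcV i hA), hr A (hcV i hA)⟩, fun x => ?_⟩
    have : x ∈ ⋃₀ V := by rw [hV.2]; trivial
    obtain ⟨A, hA, hxA⟩ := this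
    obtain ⟨S, hAS, hS⟩ := hc x A hA
    exact ⟨S, A, hAS, hxA, hS⟩
  choose ι hι c hc1 hc2 using step
  choose F hFc hF using fun p : Σ n, ι n =>
    aux_map (c p.1 p.2) (fun A hA => (hc1 p.1 p.2 A hA).1)
  let Φ : X → (p : Σ n, ι n) → UniformFun (c p.1 p.2) ℝ := fun x p => F p x
  have hΦ : Continuous Φ := continuous_pi hFc
  have hind : IsInducing Φ := by
    rw [isInducing_iff_nhds]
    intro x
    refine le_antisymm (Filter.map_le_iff_le_comap.1 hΦ.continuousAt) ?_
    intro U hU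
    obtain ⟨U', hU'U, hU', hx⟩ := mem_nhds_iff.1 hU
    obtain ⟨n, hn⟩ := hG.2 x U' hU' hx
    obtain ⟨i, A, hA, hxA, hlf⟩ := hc2 n x
    obtain ⟨g, hg, hAg⟩ := (hc1 n i A hA).2
    have hev : Continuous fun φ : (p : Σ n, ι n) → UniformFun (c p.1 p.2) ℝ =>
        UniformFun.toFun (φ ⟨n, i⟩) ⟨A, hA⟩ :=
      (UniformFun.uniformContinuous_eval ℝ (⟨A, hA⟩ : c n i)).continuous.comp
        (continuous_apply (⟨n, i⟩ : Σ n, ι n))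
    refine ⟨{φ | 0 < UniformFun.toFun (φ ⟨n, i⟩) ⟨A, hA⟩},
      (isOpen_lt continuous_const hev).mem_nhds ((hF ⟨n, i⟩ ⟨A, hA⟩ x).2 ⟨hxA, hlf⟩), ?_⟩
    intro y hy
    have hyA := ((hF ⟨n, i⟩ ⟨A, hA⟩ y).1 hy).1
    exact hU'U (hn ⟨g, ⟨hg, hAg hxA⟩, hAg hyA⟩)
  have : PseudoMetrizableSpace X := hind.pseudoMetrizableSpace
  infer_instance
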